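/- arXiv:1309.1020 — 2 statements merged into one kernel-verified Lean document; each statement's English description precedes it below -/
import Mathlib

section
/- Let G be a finite simple claw-free graph such that χ(G) > ω(G). Then there exists a clique K in G with |K| ≤ 5 such that χ(G \ K) > χ(G) − |K|. -/
open SimpleGraph

/-- A graph is claw-free if it has no induced `K_{1,3}`. -/
def ClawFree {V : Type*} (G : SimpleGraph V) : Prop :=
  ¬ ∃ u a b c : V, a ≠ b ∧ a ≠ c ∧ b ≠ c ∧
    G.Adj u a ∧ G.Adj u b ∧ G.Adj u c ∧ ¬ G.Adj a b ∧ ¬ G.Adj a c ∧ ¬ G.Adj b c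

/-- `x` is a common neighbour of the vertices in `K`. -/
def CN {V : Type*} (G : SimpleGraph V) (K : Finset V) (x : V) : Prop :=
  ∀ u ∈ K, G.Adj u x

/-- `c` restricts to a proper colouring of `G \ K` with colours `< n`. -/
def PC {V : Type*} (G : SimpleGraph V) (K : Finset V) (n : ℕ) (c : V → ℕ) : Prop :=
  (∀ x, x ∉ K → c x < n) ∧ ∀ x y, x ∉ K → y ∉ K → G.Adj x y → c x ≠ c y

theorem colorable_of_map {V α : Type*} (G : SimpleGraph V) (S : Finset α) (F : V → α)
    (hF : ∀ x, F x ∈ S) (hp : ∀ x y, G.Adj x y → F x ≠ F y) : G.Colorable S.card := by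
  have := (Coloring.mk (G := G) (α := S) (fun x => ⟨F x, hF x⟩)
    (fun {x y} hxy he => hp x y hxy (by simpa using he))).colorable
  simpa using this

theorem lemX {V : Type*} (G : SimpleGraph V) (K : Finset V) (n : ℕ)
    (c : V → ℕ) (hc : PC G K n c) (δ ρ : ℕ) (hδ : δ < n) (B : Set V) (h : V → V)
    (H1 : ∀ b ∈ B, b ∉ K ∧ h b ∉ K ∧ c (h b) ≠ δ)
    (H2 : ∀ b ∈ B, ∀ b' ∈ B, c (h b) = c (h b') → b = b')
    (H3 : ∀ b ∈ B, ∀ e, e ∉ K → e ∉ B → c e = c (h b) → G.Adj b e → c e = ρ ∧ ¬ CN G K e)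
    (H4 : ∀ e, e ∉ K → c e = δ → e ∈ B ∨ (δ = ρ ∧ ¬ CN G K e)) :
    G.Colorable (n - 1 + K.card) := by
  classical
  have hu : ∀ x, ∃ u, ¬ CN G K x → u ∈ K ∧ ¬ G.Adj u x := by
    intro x
    by_cases hx : CN G K x
    · exact ⟨x, fun h => absurd hx h⟩
    · have := hx
      unfold CN at this
      push Not at this
      obtain ⟨u, hu⟩ := this
      exact ⟨u, fun _ => hu⟩
  choose u hu using hu
  obtain ⟨hc1, hc2⟩ := hc
  let F : V → ℕ ⊕ V := fun x =>
    if x ∈ K then Sum.inr x else if x ∈ B then Sum.inl (c (h x)) else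
      if c x = ρ ∧ ¬ CN G K x then Sum.inr (u x) else Sum.inl (c x)
  have := colorable_of_map G (((Finset.range n).erase δ).disjSum K) F ?_ ?_
  · rwa [Finset.card_disjSum, Finset.card_erase_of_mem (by simpa using hδ), Finset.card_range] at this
  · intro x
    simp only [F]
    split_ifs with h1 h2 h3
    · simpa using h1
    · have := H1 x h2
      have := hc1 _ this.2.1
      simp; tauto
    · simpa using (hu x h3.2).1
    · have := H4 x h1
      have := hc1 x h1
      simp only [Finset.inl_mem_disjSum, Finset.mem_erase, Finset.mem_range]
      refine ⟨?_, this⟩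
      rintro rfl
      rcases H4 x h1 rfl with h | h
      · exact h2 h
      · exact h3 ⟨h.1, h.2⟩
  · intro x y hxy
    simp only [F]
    have hne := hxy.ne
    have hyx := hxy.symm
    have e1 := hc2 x y
    split_ifs with h1 h2 h3 h4 h5 h6 h7 h8 h9 h10 h11 h12 <;> simp only [ne_eq, reduceCtorEq, not_false_eq_true, Sum.inl.injEq, Sum.inr.injEq] <;> intro he <;> grind

theorem CN.not_mem {V : Type*} {G : SimpleGraph V} {K : Finset V} {x : V} (h : CN G K x) :
    x ∉ K := fun hx => (h x hx).ne rfl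

theorem lemA {V : Type*} (G : SimpleGraph V) (K : Finset V) (n : ℕ)
    (c : V → ℕ) (hc : PC G K n c) (hn : ¬ G.Colorable (n - 1 + K.card)) (i : ℕ) (hi : i < n) :
    ∃ x, c x = i ∧ CN G K x := by
  by_contra hcon
  push Not at hcon
  apply hn
  apply lemX G K n c hc i i hi ∅ id <;> simp
  exact fun e _ he => hcon e he

theorem not_clique {V : Type*} [Fintype V] (G : SimpleGraph V) (K : Finset V) (n : ℕ)
    (hK : G.IsClique (↑K : Set V))
    (c : V → ℕ) (hc : PC G K n c) (hn : ¬ G.Colorable (n - 1 + K.card))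
    (hω : G.cliqueNum < n + K.card) :
    ∃ t t', CN G K t ∧ CN G K t' ∧ t ≠ t' ∧ ¬ G.Adj t t' := by
  classical
  by_contra hcon
  push Not at hcon
  have hA : ∀ i : Fin n, ∃ x, c x = i ∧ CN G K x := fun i => lemA G K n c hc hn i i.2
  choose s hs using hA
  have hinj : Function.Injective s := by
    intro i j hij
    have h1 := (hs i).1
    have h2 := (hs j).1
    rw [hij] at h1
    exact Fin.ext (h1.symm.trans h2)
  let S : Finset V := Finset.univ.image s ∪ K
  have hcl : G.IsClique (↑S : Set V) := by
    intro x hx y hy hxy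
    simp only [S, Finset.coe_union, Finset.coe_image, Finset.coe_univ, Set.image_univ,
      Set.mem_union, Set.mem_range, Finset.mem_coe] at hx hy
    rcases hx with ⟨i, rfl⟩ | hx
    · rcases hy with ⟨j, rfl⟩ | hy
      · exact hcon _ _ (hs i).2 (hs j).2 hxy
      · exact ((hs i).2 y hy).symm
    · rcases hy with ⟨j, rfl⟩ | hy
      · exact (hs j).2 x hx
      · exact hK hx hy hxy
  have hcard : S.card = n + K.card := by
    rw [Finset.card_union_of_disjoint, Finset.card_image_of_injective _ hinj]
    · simp
    · rw [Finset.disjoint_left]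
      intro x hx
      simp only [Finset.mem_image, Finset.mem_univ, true_and] at hx
      obtain ⟨i, rfl⟩ := hx
      exact (hs i).2.not_mem
  have := hcl.card_le_cliqueNum
  omega

/-- `f` swaps the two common neighbours of `K` in a colour class. -/
def Mate {V : Type*} (G : SimpleGraph V) (K : Finset V) (c : V → ℕ) (f : V → V) : Prop :=
  Function.Involutive f ∧ (∀ x, f x ≠ x → CN G K x ∧ CN G K (f x) ∧ c (f x) = c x) ∧
    ∀ x y, CN G K x → CN G K y → c x = c y → y = x ∨ y = f x

theorem mates {V : Type*} (G : SimpleGraph V) (hcf : ClawFree G) (K : Finset V) (n : ℕ)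
    (c : V → ℕ) (hc : PC G K n c) (hK : K.Nonempty) : ∃ f, Mate G K c f := by
  classical
  obtain ⟨u, hu⟩ := hK
  have three : ∀ x y z, CN G K x → CN G K y → CN G K z → c x = c y → c x = c z →
      x ≠ y → x ≠ z → y ≠ z → False := by
    intro x y z hx hy hz h1 h2 h3 h4 h5
    exact hcf ⟨u, x, y, z, h3, h4, h5, hx u hu, hy u hu, hz u hu,
      fun h => hc.2 x y hx.not_mem hy.not_mem h h1,
      fun h => hc.2 x z hx.not_mem hz.not_mem h h2,
      fun h => hc.2 y z hy.not_mem hz.not_mem h (h1.symm.trans h2)⟩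
  have ex : ∀ x, ∃ y, (CN G K x ∧ (∃ y, y ≠ x ∧ CN G K y ∧ c y = c x) ∧ y ≠ x ∧ CN G K y ∧ c y = c x)
      ∨ (¬ (CN G K x ∧ ∃ y, y ≠ x ∧ CN G K y ∧ c y = c x) ∧ y = x) := by
    intro x
    by_cases h : CN G K x ∧ ∃ y, y ≠ x ∧ CN G K y ∧ c y = c x
    · obtain ⟨h1, y, hy⟩ := h
      exact ⟨y, Or.inl ⟨h1, ⟨y, hy⟩, hy⟩⟩
    · exact ⟨x, Or.inr ⟨h, rfl⟩⟩
  choose f hf using ex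
  refine ⟨f, ?_, ?_, ?_⟩
  · intro x
    rcases hf x with h | h
    · rcases hf (f x) with h' | h'
      · by_contra hne
        exact three x (f x) (f (f x)) h.1 h.2.2.2.1 h'.2.2.2.1 h.2.2.2.2.symm
          (by rw [h'.2.2.2.2, h.2.2.2.2]) h.2.2.1.symm (Ne.symm hne) h'.2.2.1.symm
      · exact absurd ⟨h.2.2.2.1, x, h.2.2.1.symm, h.1, h.2.2.2.2.symm⟩ h'.1
    · rw [h.2, h.2]
  · intro x hx
    rcases hf x with h | h
    · exact ⟨h.1, h.2.2.2⟩
    · exact absurd h.2 hx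
  · intro x y hx hy hxy
    by_contra hne
    push Not at hne
    rcases hf x with h | h
    · exact three x y (f x) hx hy h.2.2.2.1 hxy h.2.2.2.2.symm hne.1.symm h.2.2.1.symm hne.2
    · exact h.1 ⟨hx, y, hne.1, hy, hxy.symm⟩

theorem Mate.anti {V : Type*} {G : SimpleGraph V} (hcf : ClawFree G) {K : Finset V} {n : ℕ}
    {c : V → ℕ} (hc : PC G K n c) {f : V → V} (hf : Mate G K c f) {y e : V} (hy : f y ≠ y)
    (he : e ∉ K) (hce : c e = c y) (hne : ¬ CN G K e) : ∀ u ∈ K, ¬ G.Adj u e := by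
  intro u hu hue
  obtain ⟨h1, h2, h3⟩ := hf.2.1 y hy
  refine hcf ⟨u, y, f y, e, hy.symm, ?_, ?_, h1 u hu, h2 u hu, hue,
      fun h => hc.2 _ _ h1.not_mem h2.not_mem h h3.symm,
      fun h => hc.2 _ _ h1.not_mem he h hce.symm,
      fun h => hc.2 _ _ h2.not_mem he h (h3.trans hce.symm)⟩
  · rintro rfl; exact hne h1
  · rintro rfl; exact hne h2

theorem Mate.nadj {V : Type*} {G : SimpleGraph V} {K : Finset V} {n : ℕ}
    {c : V → ℕ} (hc : PC G K n c) {f : V → V} (hf : Mate G K c f) {y : V} :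
    ¬ G.Adj y (f y) := by
  intro h
  obtain ⟨h1, h2, h3⟩ := hf.2.1 y h.ne.symm
  exact hc.2 _ _ h1.not_mem h2.not_mem h h3.symm

theorem dihedral {V : Type*} [Fintype V] (f g : V → V) (hf : Function.Involutive f)
    (hg : Function.Involutive g) (t : V) (ht : f t = t) :
    0 < Function.minimalPeriod (f ∘ g) t ∧ ∃ x : ℤ → V, x 0 = t ∧
      (∀ n : ℕ, x n = (f ∘ g)^[n] t) ∧ (∀ i, f (x i) = x (-i)) ∧ (∀ i, g (x i) = x (-1 - i)) ∧
      ∀ i j, x i = x j ↔ (Function.minimalPeriod (f ∘ g) t : ℤ) ∣ i - j := by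
  let F : Equiv.Perm V := hf.toPerm
  let H : Equiv.Perm V := hg.toPerm
  let s : Equiv.Perm V := F * H
  have hFF : F * F = 1 := by ext x; exact hf x
  have hHH : H * H = 1 := by ext x; exact hg x
  have hFi : F⁻¹ = F := inv_eq_of_mul_eq_one_left hFF
  have hHi : H⁻¹ = H := inv_eq_of_mul_eq_one_left hHH
  have hsi : s⁻¹ = H * F := by simp [s, hFi, hHi]
  have conj : ∀ i : ℤ, F * s ^ i = s ^ (-i) * F := by
    intro i
    have : F * s * F⁻¹ = s⁻¹ := by
      rw [hsi, hFi]; simp only [s]; rw [← mul_assoc, hFF, one_mul]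
    have h2 : F * s ^ i * F⁻¹ = s ^ (-i) := by
      rw [← conj_zpow, this, inv_zpow']
    rw [← h2]; simp
  have hfx : ∀ i : ℤ, f ((s ^ i) t) = (s ^ (-i)) t := by
    intro i
    have := congrArg (fun p : Equiv.Perm V => p t) (conj i)
    simp only [Equiv.Perm.mul_apply] at this
    change f _ = (s ^ (-i)) (f t) at this
    rwa [ht] at this
  refine ⟨?_, fun i => (s ^ i) t, by simp, ?_, hfx, ?_, ?_⟩
  · apply Function.minimalPeriod_pos_of_mem_periodicPts
    exact (hf.injective.comp hg.injective).mem_periodicPts t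
  · intro n
    show (s ^ (n : ℤ)) t = _
    rw [zpow_natCast, ← Equiv.Perm.iterate_eq_pow]
    rfl
  · intro i
    have h1 : (s ^ (-1 - i)) t = f ((s ^ (1 + i)) t) := by rw [hfx]; congr 2; ring
    show g ((s ^ i) t) = (s ^ (-1 - i)) t
    rw [h1, zpow_add, zpow_one]
    simp only [Equiv.Perm.mul_apply]
    exact (hf _).symm
  · intro i j
    have := MulAction.zpow_smul_eq_iff_minimalPeriod_dvd (a := s) (b := t) (n := i - j)
    have e : (s • · : V → V) = f ∘ g := rfl
    rw [e] at this
    rw [← this]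
    constructor
    · intro h
      have h : (s ^ i) t = (s ^ j) t := h
      show (s ^ (i - j)) t = t
      rw [show i - j = -j + i by ring, zpow_add, Equiv.Perm.mul_apply, h, ← Equiv.Perm.mul_apply,
        ← zpow_add]
      simp
    · intro h
      have h : (s ^ (i - j)) t = t := h
      show (s ^ i) t = (s ^ j) t
      conv_rhs => rw [← h]
      rw [← Equiv.Perm.mul_apply, ← zpow_add]
      congr 2; ring

theorem lemZ {V : Type*} [Fintype V] (G : SimpleGraph V) (hcf : ClawFree G) (K : Finset V)
    (n : ℕ) (hn : ¬ G.Colorable (n - 1 + K.card)) (c c' : V → ℕ) (hc : PC G K n c)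
    (hc' : PC G K n c') (t t' : V) (ht : CN G K t) (ht' : CN G K t') (htt : ¬ G.Adj t t')
    (hs : ∀ e, e ∉ K → c e = c t → e = t) (hs' : ∀ e, e ∉ K → c' e = c' t' → e = t')
    (f g : V → V) (hf : Mate G K c f) (hg : Mate G K c' g) (As Zs : Set V)
    (htA : t ∈ As)
    (sw1 : ∀ a b, CN G K a → CN G K b → a ≠ b → ¬ G.Adj a b → a ∈ As → b ∈ Zs)
    (sw2 : ∀ a b, CN G K a → CN G K b → a ≠ b → ¬ G.Adj a b → a ∈ Zs → b ∈ As)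
    (htZ : t' ∈ Zs)
    (nobad : ∀ e b a a', e ∉ K → (∀ u ∈ K, ¬ G.Adj u e) → CN G K b → CN G K a → CN G K a' →
      b ∈ Zs → a ∈ As → a' ∈ Zs → a ≠ a' → G.Adj e b → ¬ G.Adj b a → ¬ G.Adj a a' →
      ¬ G.Adj e a → ¬ G.Adj e a' → False) :
    ∃ m, Function.minimalPeriod (f ∘ g) t = 2 * m + 1 ∧ (f ∘ g)^[m] t = t' ∧ t' ∈ As := by
  classical
  have hft : f t = t := by
    by_contra h
    obtain ⟨-, h2, h3⟩ := hf.2.1 t h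
    exact h (hs _ h2.not_mem h3)
  have hgt : g t' = t' := by
    by_contra h
    obtain ⟨-, h2, h3⟩ := hg.2.1 t' h
    exact h (hs' _ h2.not_mem h3)
  obtain ⟨hNpos, x, hx0, hxn, hfx, hgx, hxx⟩ := dihedral f g hf.1 hg.1 t hft
  generalize hN : Function.minimalPeriod (f ∘ g) t = N at *
  have key : ∀ i : ℕ, (2 * i < N → x i ∈ As ∧ CN G K (x i)) ∧
      (2 * i + 1 < N → x (-1 - i) ∈ Zs ∧ CN G K (x (-1 - i))) := by
    have step1 : ∀ i : ℕ, (2 * i + 1 < N) → x i ∈ As ∧ CN G K (x i) →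
        x (-1 - i) ∈ Zs ∧ CN G K (x (-1 - i)) := by
      intro i hi hA
      have hne : g (x i) ≠ x i := by
        rw [hgx, Ne, hxx]
        intro hd
        rw [← dvd_neg] at hd
        have := Int.le_of_dvd (by omega) hd
        omega
      have h1 := hg.2.1 _ hne
      have h2 := hg.nadj hc' (y := x i)
      rw [hgx] at h1 h2 hne
      exact ⟨sw1 _ _ h1.1 h1.2.1 hne.symm h2 hA.1, h1.2.1⟩
    intro i
    induction i with
    | zero =>
      have h0 : x ((0 : ℕ) : ℤ) ∈ As ∧ CN G K (x ((0 : ℕ) : ℤ)) := by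
        simp only [Nat.cast_zero, hx0]; exact ⟨htA, ht⟩
      exact ⟨fun _ => h0, fun h => step1 0 h h0⟩
    | succ i ih =>
      have h0 : 2 * (i + 1) < N → x ((i + 1 : ℕ) : ℤ) ∈ As ∧ CN G K (x ((i + 1 : ℕ) : ℤ)) := by
        intro hi
        obtain ⟨hZ, -⟩ := ih.2 (by omega)
        have e : -(-1 - (i : ℤ)) = ((i + 1 : ℕ) : ℤ) := by push_cast; ring
        have hne : f (x (-1 - i)) ≠ x (-1 - i) := by
          rw [hfx, Ne, hxx]
          intro hd
          have := Int.le_of_dvd (by omega) hd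
          omega
        have h1 := hf.2.1 _ hne
        have h2 := hf.nadj hc (y := x (-1 - i))
        rw [hfx, e] at h1 h2 hne
        exact ⟨sw2 _ _ h1.1 h1.2.1 hne.symm h2 hZ, h1.2.1⟩
      exact ⟨h0, fun h => step1 _ h (h0 (by omega))⟩
  rcases Nat.even_or_odd' N with ⟨m, rfl | rfl⟩
  · exfalso
    have hm : 0 < m := by omega
    have kA : ∀ i : ℕ, i < m → x i ∈ As ∧ CN G K (x i) := fun i hi => (key i).1 (by omega)
    have kZ : ∀ i : ℕ, i < m → x (-1 - i) ∈ Zs ∧ CN G K (x (-1 - i)) :=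
      fun i hi => (key i).2 (by omega)
    have hd : x (-1 - (m - 1 : ℕ)) = x (-m) := by congr 1; omega
    have hdC : CN G K (x (-m)) := hd ▸ (kZ (m - 1) (by omega)).2
    have hgZ : ∀ i : ℕ, g (x (-1 - i)) = x i := by intro i; rw [hgx]; congr 1; ring
    apply hn
    apply lemX G K n c hc (c (x (-m))) (c (x (-m))) (hc.1 _ hdC.not_mem)
      {b | ∃ i : ℕ, i < m ∧ b = x (-1 - i)} g
    · rintro b ⟨i, hi, rfl⟩
      rw [hgZ]
      refine ⟨(kZ i hi).2.not_mem, (kA i hi).2.not_mem, fun h => ?_⟩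
      rcases hf.2.2 _ _ (kA i hi).2 hdC h with h | h
      · rw [hxx, ← dvd_neg] at h
        have := Int.le_of_dvd (by omega) h
        omega
      · rw [hfx, hxx, ← dvd_neg] at h
        have := Int.le_of_dvd (by omega) h
        omega
    · rintro b ⟨i, hi, rfl⟩ b' ⟨j, hj, rfl⟩ h
      rw [hgZ, hgZ] at h
      have hij : i = j := by
        rcases hf.2.2 _ _ (kA i hi).2 (kA j hj).2 h with h | h
        · rw [hxx] at h
          have := Int.eq_zero_of_abs_lt_dvd h (by rw [abs_lt]; constructor <;> omega)
          omega
        · rw [hfx, hxx] at h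
          have := Int.eq_zero_of_abs_lt_dvd h (by rw [abs_lt]; constructor <;> omega)
          omega
      rw [hij]
    · rintro b ⟨i, hi, rfl⟩ e heK heB hce hadj
      exfalso
      rw [hgZ] at hce
      have hnad : ¬ G.Adj (x (-1 - i)) (x i) := by
        have := hg.nadj hc' (y := x (-1 - i)); rwa [hgZ] at this
      by_cases heC : CN G K e
      · rcases hf.2.2 _ _ (kA i hi).2 heC hce.symm with h | h
        · rw [h] at hadj; exact hnad hadj
        · rw [hfx] at h
          rcases Nat.eq_zero_or_pos i with rfl | hi0
          · rw [h] at hadj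
            simp at hadj hnad
            exact hnad hadj
          · exact heB ⟨i - 1, by omega, by rw [h]; congr 1; omega⟩
      · rcases Nat.eq_zero_or_pos i with rfl | hi0
        · simp only [Nat.cast_zero, hx0] at hce
          exact heC (hs e heK hce ▸ ht)
        · have hne : f (x i) ≠ x i := by
            rw [hfx, Ne, hxx, ← dvd_neg]
            intro hd
            have := Int.le_of_dvd (by omega) hd
            omega
          have han := hf.anti hcf hc hne heK hce heC
          have hm1 := hf.2.1 _ hne
          have hm2 := hf.nadj hc (y := x i)
          have hm3 : f (x i) ∈ Zs := by
            rw [hfx]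
            have := (kZ (i - 1) (by omega)).1
            convert this using 2; omega
          exact nobad e _ (x i) (f (x i)) heK han (kZ i hi).2 (kA i hi).2 hm1.2.1 (kZ i hi).1
            (kA i hi).1 hm3 hne.symm hadj.symm hnad hm2
            (fun h => hc.2 _ _ heK (kA i hi).2.not_mem h hce)
            (fun h => hc.2 _ _ heK hm1.2.1.not_mem h (hce.trans hm1.2.2.symm))
    · intro e heK hce
      by_cases heC : CN G K e
      · left
        rcases hf.2.2 _ _ hdC heC hce.symm with h | h
        · exact ⟨m - 1, by omega, by rw [h, hd]⟩
        · refine ⟨m - 1, by omega, ?_⟩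
          rw [h, hd, hfx, hxx]
          exact ⟨1, by push_cast; ring⟩
      · exact Or.inr ⟨rfl, heC⟩
  · refine ⟨m, rfl, ?_⟩
    rw [← hxn]
    have kA : ∀ i : ℕ, i ≤ m → x i ∈ As ∧ CN G K (x i) := fun i hi => (key i).1 (by omega)
    have kZ : ∀ i : ℕ, i < m → x (-1 - i) ∈ Zs ∧ CN G K (x (-1 - i)) :=
      fun i hi => (key i).2 (by omega)
    by_cases hxm : x m = t'
    · exact ⟨hxm, hxm ▸ (kA m le_rfl).1⟩
    exfalso
    have hnot : ∀ i, x i ≠ t' := by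
      intro i hi
      have h1 := hgx i
      rw [hi, hgt, ← hi, hxx] at h1
      apply hxm
      rw [← hi, hxx]
      obtain ⟨q, hq⟩ := h1
      rcases Int.even_or_odd' q with ⟨r, rfl | rfl⟩
      · exfalso
        have : 2 * ((2 * m + 1 : ℕ) * r - i) = (1 : ℤ) := by linear_combination -hq
        omega
      · refine ⟨-r, ?_⟩
        push_cast at hq ⊢
        linarith
    let y : ℕ → V := fun j => if j = 0 then t' else x (-j)
    let h : V → V := fun b => if b = t' then t else f b
    have hy : ∀ j, h (y j) = x j := by
      intro j
      by_cases hj : j = 0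
      · simp [h, y, hj, hx0]
      · simp only [h, y, hj, if_false]
        rw [if_neg (hnot _), hfx, neg_neg]
    have hyZ : ∀ j ≤ m, y j ∈ Zs ∧ CN G K (y j) := by
      intro j hj
      by_cases hj0 : j = 0
      · simp only [y, hj0, if_true]; exact ⟨htZ, ht'⟩
      · simp only [y, hj0, if_false]
        have := kZ (j - 1) (by omega)
        have e : -1 - ((j - 1 : ℕ) : ℤ) = -j := by omega
        rwa [e] at this
    have hyn : ∀ j, ¬ G.Adj (y j) (x j) := by
      intro j
      by_cases hj0 : j = 0
      · simp only [y, hj0, if_true, Nat.cast_zero, hx0]; exact fun h => htt h.symm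
      · simp only [y, hj0, if_false]
        have := hf.nadj hc (y := x (-j)); rwa [hfx, neg_neg] at this
    apply hn
    apply lemX G K n c' hc' (c' t') (c' (x m)) (hc'.1 _ ht'.not_mem)
      {b | ∃ j : ℕ, j ≤ m ∧ b = y j} h
    · rintro b ⟨j, hj, rfl⟩
      rw [hy]
      exact ⟨(hyZ j hj).2.not_mem, (kA j hj).2.not_mem,
        fun h => hnot _ (hs' _ (kA j hj).2.not_mem h)⟩
    · rintro b ⟨i, hi, rfl⟩ b' ⟨j, hj, rfl⟩ h
      rw [hy, hy] at h
      have hij : i = j := by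
        rcases hg.2.2 _ _ (kA i hi).2 (kA j hj).2 h with h | h
        · rw [hxx] at h
          have := Int.eq_zero_of_abs_lt_dvd h (by rw [abs_lt]; constructor <;> omega)
          omega
        · rw [hgx, hxx] at h
          have := Int.le_of_dvd (by omega) h
          omega
      rw [hij]
    · rintro b ⟨j, hj, rfl⟩ e heK heB hce hadj
      rw [hy] at hce
      have hnad := hyn j
      by_cases heC : CN G K e
      · exfalso
        rcases hg.2.2 _ _ (kA j hj).2 heC hce.symm with h | h
        · rw [h] at hadj; exact hnad hadj
        · rw [hgx] at h
          by_cases hjm : j = m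
          · have : x (-1 - j) = x j := by
              rw [hxx]; exact ⟨-1, by rw [hjm]; push_cast; ring⟩
            rw [h, this] at hadj; exact hnad hadj
          · refine heB ⟨j + 1, by omega, ?_⟩
            simp only [y, Nat.add_eq_zero_iff, one_ne_zero, and_false, if_false]
            rw [h]; congr 1; push_cast; ring
      · by_cases hjm : j = m
        · exact ⟨by rw [hce, hjm], heC⟩
        · exfalso
          have hne : g (x j) ≠ x j := by
            rw [hgx, Ne, hxx, ← dvd_neg]
            intro hd
            have := Int.le_of_dvd (by omega) hd
            omega
          have han := hg.anti hcf hc' hne heK hce heC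
          have hm1 := hg.2.1 _ hne
          have hm2 := hg.nadj hc' (y := x j)
          have hm3 : g (x j) ∈ Zs := by
            rw [hgx]
            exact (kZ j (by omega)).1
          exact nobad e _ (x j) (g (x j)) heK han (hyZ j hj).2 (kA j hj).2 hm1.2.1 (hyZ j hj).1
            (kA j hj).1 hm3 hne.symm hadj.symm hnad hm2
            (fun h => hc'.2 _ _ heK (kA j hj).2.not_mem h hce)
            (fun h => hc'.2 _ _ heK hm1.2.1.not_mem h (hce.trans hm1.2.2.symm))
    · intro e heK hce
      exact Or.inl ⟨0, by omega, by simp [y, hs' e heK hce]⟩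

theorem claw_elim {V : Type*} {G : SimpleGraph V} (hcf : ClawFree G) {u a b c : V}
    (hab : a ≠ b) (hac : a ≠ c) (hbc : b ≠ c) (ua : G.Adj u a) (ub : G.Adj u b)
    (uc : G.Adj u c) : G.Adj a b ∨ G.Adj a c ∨ G.Adj b c := by
  by_contra h
  push Not at h
  exact hcf ⟨u, a, b, c, hab, hac, hbc, ua, ub, uc, h⟩

/-- The colour of `t` in `c` is used only at `t` outside `K`. -/
def Single {V : Type*} (K : Finset V) (c : V → ℕ) (t : V) : Prop :=
  ∀ e, e ∉ K → c e = c t → e = t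

theorem Mate.fixed {V : Type*} {G : SimpleGraph V} {K : Finset V}
    {c : V → ℕ} {f : V → V} (hf : Mate G K c f) {t : V} (hs : Single K c t) : f t = t := by
  by_contra h
  obtain ⟨-, h2, h3⟩ := hf.2.1 t h
  exact h (hs _ h2.not_mem h3)

theorem PC.ext {V : Type*} [DecidableEq V] {G : SimpleGraph V} {K : Finset V} {n : ℕ} {c : V → ℕ}
    {t : V} (hc : PC G (insert t K) n c) : ∃ c2, PC G K (n + 1) c2 ∧ Single K c2 t ∧
      ∀ s, s ∉ insert t K → Single (insert t K) c s → Single K c2 s := by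
  obtain ⟨h1, h2⟩ := hc
  refine ⟨fun x => if x = t then n else c x, ⟨?_, ?_⟩, ?_, ?_⟩
  · intro x hx
    by_cases hxt : x = t
    · simp [hxt]
    · have := h1 x (by simp [hxt, hx])
      simp [hxt]; omega
  · intro x y hx hy hxy
    by_cases hxt : x = t <;> by_cases hyt : y = t
    · exact absurd (hxt.trans hyt.symm) hxy.ne
    · have := h1 y (by simp [hyt, hy])
      simp [hxt, hyt]; omega
    · have := h1 x (by simp [hxt, hx])
      simp [hxt, hyt]; omega
    · simp only [hxt, hyt, if_false]
      exact h2 x y (by simp [hxt, hx]) (by simp [hyt, hy]) hxy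
  · intro e he hce
    by_contra hne
    have := h1 e (by simp [hne, he])
    simp [hne] at hce; omega
  · intro s hs hsing e he hce
    have hst : s ≠ t := by rintro rfl; simp at hs
    by_cases hne : e = t
    · have := h1 s hs
      simp [hst, hne] at hce; omega
    · simp only [hst, hne, if_false] at hce
      exact hsing e (by simp [hne, he]) hce

theorem CN.insert_clique {V : Type*} [DecidableEq V] {G : SimpleGraph V} {K : Finset V}
    (hK : G.IsClique (↑K : Set V)) {t : V} (ht : CN G K t) :
    G.IsClique (↑(insert t K) : Set V) := by
  rw [Finset.coe_insert, isClique_insert]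
  exact ⟨hK, fun b hb _ => (ht b hb).symm⟩

theorem cn_insert {V : Type*} [DecidableEq V] {G : SimpleGraph V} {K : Finset V} {t x : V} :
    CN G (insert t K) x ↔ G.Adj t x ∧ CN G K x := by
  simp [CN]

/-- Criticality: every clique of size at most five can be removed lowering the chromatic number
as much as possible. -/
def Crit {V : Type*} (G : SimpleGraph V) (k : ℕ) : Prop :=
  ∀ K : Finset V, G.IsClique (↑K : Set V) → K.card ≤ 5 → K.card < k ∧ ∃ c, PC G K (k - K.card) c

theorem Crit.single {V : Type*} {G : SimpleGraph V} {k : ℕ} (hcr : Crit G k) {K : Finset V}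
    (hK : G.IsClique (↑K : Set V)) (hcard : K.card ≤ 4) {t : V} (ht : CN G K t) :
    ∃ c, PC G K (k - K.card) c ∧ Single K c t := by
  classical
  have h1 := Finset.card_insert_of_notMem ht.not_mem
  obtain ⟨h2, c, hc⟩ := hcr (insert t K) (ht.insert_clique hK) (by omega)
  obtain ⟨c2, h3, h4, -⟩ := hc.ext
  refine ⟨c2, ?_, h4⟩
  rwa [show k - (insert t K).card + 1 = k - K.card by omega] at h3

theorem Crit.ncol {V : Type*} {G : SimpleGraph V} {k : ℕ} (hcr : Crit G k)
    (hk : ¬ G.Colorable (k - 1)) {K : Finset V}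
    (hK : G.IsClique (↑K : Set V)) (hcard : K.card ≤ 5) :
    ¬ G.Colorable (k - K.card - 1 + K.card) := by
  have := (hcr K hK hcard).1
  rwa [show k - K.card - 1 + K.card = k - 1 by omega]

theorem Crit.pair {V : Type*} [Fintype V] {G : SimpleGraph V} {k : ℕ} (hcr : Crit G k)
    (hk : ¬ G.Colorable (k - 1)) (hω : G.cliqueNum < k) {K : Finset V}
    (hK : G.IsClique (↑K : Set V)) (hcard : K.card ≤ 5) :
    ∃ t t', CN G K t ∧ CN G K t' ∧ t ≠ t' ∧ ¬ G.Adj t t' := by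
  obtain ⟨h1, c, hc⟩ := hcr K hK hcard
  exact not_clique G K _ hK c hc (hcr.ncol hk hK hcard) (by omega)

theorem noStar {V : Type*} [Fintype V] {G : SimpleGraph V} (hcf : ClawFree G) {k : ℕ}
    (hcr : Crit G k) (hk : ¬ G.Colorable (k - 1)) (hω : G.cliqueNum < k) (v : V)
    (hstar : ∀ e w p q, ¬ G.Adj v e → v ≠ e → G.Adj w v → G.Adj w e → G.Adj v p → G.Adj v q →
      p ≠ q → ¬ G.Adj p q → ¬ G.Adj e p → ¬ G.Adj e q → False) : False := by
  classical
  have hK : G.IsClique (↑({v} : Finset V) : Set V) := by simp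
  have hcn : ∀ x, CN G {v} x ↔ G.Adj v x := by intro x; simp [CN]
  have hne : ({v} : Finset V).Nonempty := by simp
  have hZ : ∀ (c c' : V → ℕ) (f g : V → V) (t t' : V), PC G {v} (k - 1) c → PC G {v} (k - 1) c' →
      CN G {v} t → CN G {v} t' → ¬ G.Adj t t' → Single {v} c t → Single {v} c' t' →
      Mate G {v} c f → Mate G {v} c' g →
      ∃ m, Function.minimalPeriod (f ∘ g) t = 2 * m + 1 ∧ (f ∘ g)^[m] t = t' := by
    intro c c' f g t t' hc hc' ht ht' htt hs hs' hf hg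
    obtain ⟨m, h1, h2, -⟩ := lemZ G hcf {v} (k - 1) (hcr.ncol hk hK (by simp)) c c' hc hc' t t' ht ht' htt hs hs'
      f g hf hg Set.univ Set.univ trivial (fun _ _ _ _ _ _ _ => trivial)
      (fun _ _ _ _ _ _ _ => trivial) trivial (by
        intro e b a a' heK he hb ha ha' _ _ _ haa heb hba haa' hea hea'
        exact hstar e b a a' (he v (by simp)) (by rintro rfl; simp at heK) ((hcn b).1 hb).symm
          heb.symm ((hcn a).1 ha) ((hcn a').1 ha') haa haa' hea hea')
    exact ⟨m, h1, h2⟩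
  obtain ⟨t, t', ht, ht', htt, hn⟩ := hcr.pair hk hω hK (by simp)
  obtain ⟨c, hc, hs⟩ := hcr.single hK (by simp) ht
  obtain ⟨c', hc', hs'⟩ := hcr.single hK (by simp) ht'
  obtain ⟨f, hf⟩ := mates G hcf _ _ c hc hne
  obtain ⟨g, hg⟩ := mates G hcf _ _ c' hc' hne
  obtain ⟨m, hm1, hm2⟩ := hZ c c' f g t t' hc hc' ht ht' hn hs hs' hf hg
  have hgt : g t ≠ t := by
    intro h
    have : Function.minimalPeriod (f ∘ g) t = 1 := by
      rw [Function.minimalPeriod_eq_one_iff_isFixedPt]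
      show f (g t) = t
      rw [h, hf.fixed hs]
    have hm0 : m = 0 := by omega
    rw [hm0] at hm2
    exact htt hm2
  obtain ⟨-, hw, -⟩ := hg.2.1 t hgt
  have hwt : ¬ G.Adj t (g t) := hg.nadj hc'
  have hwt' : g t ≠ t' := by
    intro h
    have := hg.1 t
    rw [h, hg.fixed hs'] at this
    exact htt this.symm
  generalize g t = w at *
  have hadj : G.Adj t' w := by
    rcases claw_elim hcf htt hgt.symm hwt'.symm ((hcn t).1 ht) ((hcn t').1 ht') ((hcn w).1 hw)
      with h | h | h
    · exact absurd h hn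
    · exact absurd h hwt
    · exact h
  have hwK : CN G (insert t' {v}) w := cn_insert.2 ⟨hadj, hw⟩
  have hK2 := ht'.insert_clique hK
  have hcard2 : (insert t' {v} : Finset V).card = 2 := by
    rw [Finset.card_insert_of_notMem ht'.not_mem]; simp
  obtain ⟨d, hd, hdw⟩ := hcr.single hK2 (by omega) hwK
  obtain ⟨d2, hd2, hd2t, hd2w⟩ := hd.ext
  have hd2w := hd2w w hwK.not_mem hdw
  have hk2 := (hcr _ hK2 (by omega)).1
  rw [hcard2] at hk2
  rw [hcard2, show k - 2 + 1 = k - 1 by omega] at hd2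
  obtain ⟨f2, hf2⟩ := mates G hcf _ _ d2 hd2 hne
  obtain ⟨g2, hg2⟩ := mates G hcf _ _ c hc hne
  obtain ⟨m1, h11, h12⟩ := hZ d2 c f2 g2 t' t hd2 hc ht' ht (fun h => hn h.symm) hd2t hs hf2 hg2
  obtain ⟨m2, h21, h22⟩ := hZ d2 c f2 g2 w t hd2 hc hw ht (fun h => hwt h.symm) hd2w hs hf2 hg2
  have hinj : Function.Injective (f2 ∘ g2) := hf2.1.injective.comp hg2.1.injective
  have p1 := Function.minimalPeriod_apply_iterate (hinj.mem_periodicPts t') m1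
  have p2 := Function.minimalPeriod_apply_iterate (hinj.mem_periodicPts w) m2
  rw [h12, h11] at p1
  rw [h22, h21] at p2
  have hmm : m1 = m2 := by omega
  subst hmm
  exact hwt' (hinj.iterate m1 (h22.trans h12.symm))

theorem finish {V : Type*} [Fintype V] {G : SimpleGraph V} (hcf : ClawFree G) {k : ℕ}
    (hcr : Crit G k) (hk : ¬ G.Colorable (k - 1)) (hω : G.cliqueNum < k) (K : Finset V)
    (hK : G.IsClique (↑K : Set V)) (hcard : K.card ≤ 4) (hne : K.Nonempty) (e0 : V)
    (hY : ∀ a b, CN G K a → CN G K b → a ≠ b → G.Adj e0 a → G.Adj e0 b → G.Adj a b)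
    (hZ : ∀ a b, CN G K a → CN G K b → a ≠ b → ¬ G.Adj e0 a → ¬ G.Adj e0 b → G.Adj a b)
    (nobad : ∀ e b a a', e ∉ K → (∀ u ∈ K, ¬ G.Adj u e) → CN G K b → CN G K a → CN G K a' →
      ¬ G.Adj e0 b → G.Adj e0 a → ¬ G.Adj e0 a' → a ≠ a' → G.Adj e b → ¬ G.Adj b a →
      ¬ G.Adj a a' → ¬ G.Adj e a → ¬ G.Adj e a' → False) : False := by
  have main : ∀ t t', CN G K t → CN G K t' → t ≠ t' → ¬ G.Adj t t' → G.Adj e0 t →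
      ¬ G.Adj e0 t' → False := by
    intro t t' ht ht' _ hn h1 h2
    obtain ⟨c, hc, hs⟩ := hcr.single hK hcard ht
    obtain ⟨c', hc', hs'⟩ := hcr.single hK hcard ht'
    obtain ⟨f, hf⟩ := mates G hcf _ _ c hc hne
    obtain ⟨g, hg⟩ := mates G hcf _ _ c' hc' hne
    obtain ⟨m, -, -, h⟩ := lemZ G hcf K _ (hcr.ncol hk hK (by omega)) c c' hc hc' t t' ht ht' hn
      hs hs' f g hf hg {x | G.Adj e0 x} {x | ¬ G.Adj e0 x} h1
      (fun a b ha hb hab hn h h' => hn (hY a b ha hb hab h h'))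
      (fun a b ha hb hab hn h => by
        by_contra h'
        exact hn (hZ a b ha hb hab h h')) h2 nobad
    exact h2 h
  obtain ⟨t, t', ht, ht', htt, hn⟩ := hcr.pair hk hω hK (by omega)
  by_cases h1 : G.Adj e0 t <;> by_cases h2 : G.Adj e0 t'
  · exact hn (hY _ _ ht ht' htt h1 h2)
  · exact main t t' ht ht' htt hn h1 h2
  · exact main t' t ht' ht htt.symm (fun h => hn h.symm) h2 h1
  · exact hn (hZ _ _ ht ht' htt h1 h2)

theorem star {V : Type*} [Fintype V] {G : SimpleGraph V} (hcf : ClawFree G) {k : ℕ}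
    (hcr : Crit G k) (hk : ¬ G.Colorable (k - 1)) (hω : G.cliqueNum < k) (v e w p q : V)
    (hve : ¬ G.Adj v e) (hve' : v ≠ e) (hwv : G.Adj w v) (hwe : G.Adj w e) (hvp : G.Adj v p)
    (hvq : G.Adj v q) (hpq' : p ≠ q) (hpq : ¬ G.Adj p q) (hep : ¬ G.Adj e p)
    (heq : ¬ G.Adj e q) (hwp : ¬ G.Adj w p) (hwq : G.Adj w q) : False := by
  classical
  let K : Finset V := {v, w, q}
  have hcn : ∀ x, CN G K x ↔ G.Adj v x ∧ G.Adj w x ∧ G.Adj q x := by intro x; simp [CN, K]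
  have hKc : G.IsClique (↑K : Set V) := by
    simp only [K, Finset.coe_insert, Finset.coe_singleton, isClique_insert]
    simp [hwv.symm, hvq, hwq]
  have hcard : K.card ≤ 3 := Finset.card_le_three
  have hne : K.Nonempty := ⟨v, by simp [K]⟩
  have hvK : v ∈ K := by simp [K]
  have hZ : ∀ a b, CN G K a → CN G K b → a ≠ b → ¬ G.Adj e a → ¬ G.Adj e b → G.Adj a b := by
    intro a b ha hb hab h1 h2
    rw [hcn] at ha hb
    rcases claw_elim hcf (u := w) (a := e) (b := a) (c := b) (by rintro rfl; exact hve ha.1)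
      (by rintro rfl; exact hve hb.1) hab hwe ha.2.1 hb.2.1 with h | h | h
    · exact absurd h h1
    · exact absurd h h2
    · exact h
  have hYp : ∀ a, CN G K a → G.Adj e a → ¬ G.Adj a p := by
    intro a ha h1 hap
    rw [hcn] at ha
    rcases claw_elim hcf (u := a) (a := e) (b := p) (c := q) (by rintro rfl; exact hve hvp)
      (by rintro rfl; exact hve hvq) hpq' h1.symm hap ha.2.2.symm with h | h | h
    · exact hep h
    · exact heq h
    · exact hpq h
  have hY : ∀ a b, CN G K a → CN G K b → a ≠ b → G.Adj e a → G.Adj e b → G.Adj a b := by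
    intro a b ha hb hab h1 h2
    have hap := hYp a ha h1
    have hbp := hYp b hb h2
    rw [hcn] at ha hb
    rcases claw_elim hcf (u := v) (a := a) (b := b) (c := p) hab (by rintro rfl; exact hep h1)
      (by rintro rfl; exact hep h2) ha.1 hb.1 hvp with h | h | h
    · exact h
    · exact absurd h hap
    · exact absurd h hbp
  let Bad : V → V → V → V → Prop := fun g b a a' =>
    (∀ u ∈ K, ¬ G.Adj u g) ∧ CN G K b ∧ CN G K a ∧ CN G K a' ∧
      ¬ G.Adj e b ∧ G.Adj e a ∧ ¬ G.Adj e a' ∧ a ≠ a' ∧ G.Adj g b ∧ ¬ G.Adj b a ∧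
      ¬ G.Adj a a' ∧ ¬ G.Adj g a ∧ ¬ G.Adj g a'
  by_cases hbad : ∃ g b a a', Bad g b a a'
  · let S : V → Finset V := fun g => Finset.univ.filter
      (fun z => G.Adj g z ∧ CN G K z ∧ ¬ G.Adj e z)
    obtain ⟨g0, hg0, hmax⟩ := Finset.exists_max_image
      (Finset.univ.filter (fun g => ∃ b a a', Bad g b a a')) (fun g => (S g).card) (by
        obtain ⟨g, hg⟩ := hbad
        exact ⟨g, by simpa using hg⟩)
    simp only [Finset.mem_filter, Finset.mem_univ, true_and] at hg0 hmax
    obtain ⟨b0, y0, a0, hanti0, hb0, hy0, ha0, heb0, hey0, hea0, hya0, hgb0, hby0, hna0, hgy0,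
      hga0⟩ := hg0
    have hcneq : ∀ {x g}, CN G K x → (∀ u ∈ K, ¬ G.Adj u g) → g ≠ x := by
      rintro x g hx hg rfl
      exact hg v hvK (hx v hvK)
    have hsub : ∀ {x}, CN G (insert y0 K) x → CN G K x := fun h => (cn_insert.1 h).2
    refine finish hcf hcr hk hω (insert y0 K) (hy0.insert_clique hKc) ?_ ⟨y0, by simp⟩ e
      (fun a b ha hb => hY a b (hsub ha) (hsub hb)) (fun a b ha hb => hZ a b (hsub ha) (hsub hb)) ?_
    · rw [Finset.card_insert_of_notMem hy0.not_mem]; omega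
    · intro g b a a' hgK hanti hb ha ha' heb hea hea' haa hgb hba hnaa hga hga'
      have hgy : ¬ G.Adj g y0 := fun h => hanti y0 (by simp) h.symm
      have hgy' : g ≠ y0 := by rintro rfl; simp at hgK
      have hantiK : ∀ u ∈ K, ¬ G.Adj u g := fun u hu => hanti u (by simp [hu])
      have hbK := hsub hb
      have hby : G.Adj y0 b := (cn_insert.1 hb).1
      have hle := hmax g ⟨b, a, a', hantiK, hbK, hsub ha, hsub ha', heb, hea, hea', haa, hgb,
        hba, hnaa, hga, hga'⟩
      have hz : ∀ z, G.Adj g0 z → CN G K z → ¬ G.Adj e z → ¬ G.Adj z y0 := by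
        intro z h1 h2 h3 h4
        have hza : z ≠ a0 := by rintro rfl; exact hga0 h1
        rcases claw_elim hcf (u := z) (a := g0) (b := y0) (c := a0) (hcneq hy0 hanti0)
          (hcneq ha0 hanti0) hya0 h1.symm h4 (hZ z a0 h2 ha0 hza h3 hea0) with h | h | h
        · exact hgy0 h
        · exact hga0 h
        · exact hna0 h
      have hlt : (S g0).card < (S g).card := by
        apply Finset.card_lt_card
        rw [Finset.ssubset_iff_of_subset]
        · refine ⟨b, by simp [S, hgb, hbK, heb], ?_⟩
          intro hb'
          simp only [S, Finset.mem_filter, Finset.mem_univ, true_and] at hb'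
          exact hz b hb'.1 hbK heb hby.symm
        · intro z hzS
          simp only [S, Finset.mem_filter, Finset.mem_univ, true_and] at hzS ⊢
          refine ⟨?_, hzS.2⟩
          have hzy := hz z hzS.1 hzS.2.1 hzS.2.2
          have hbz : b ≠ z := by rintro rfl; exact hzy hby.symm
          rcases claw_elim hcf (u := b) (a := g) (b := y0) (c := z) hgy'
            (hcneq hzS.2.1 hantiK) (by rintro rfl; exact hzS.2.2 hey0) hgb.symm hby.symm
            (hZ b z hbK hzS.2.1 hbz heb hzS.2.2) with h | h | h
          · exact absurd h hgy
          · exact h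
          · exact absurd h.symm hzy
      omega
  · refine finish hcf hcr hk hω K hKc (by omega) hne e hY hZ ?_
    intro g b a a' _ hanti hb ha ha' heb hea hea' haa hgb hba hnaa hga hga'
    exact hbad ⟨g, b, a, a', hanti, hb, ha, ha', heb, hea, hea', haa, hgb,
        hba, hnaa, hga, hga'⟩

theorem core {V : Type*} [Fintype V] {G : SimpleGraph V} (hcf : ClawFree G) {k : ℕ}
    (hcr : Crit G k) (hk : ¬ G.Colorable (k - 1)) (hω : G.cliqueNum < k) : False := by
  rcases isEmpty_or_nonempty V with hV | ⟨⟨v⟩⟩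
  · exact hk (Colorable.of_isEmpty _)
  refine noStar hcf hcr hk hω v ?_
  intro e w p q hve hve' hwv hwe hvp hvq hpq' hpq hep heq
  have hep' : e ≠ p := by rintro rfl; exact hve hvp
  have heq' : e ≠ q := by rintro rfl; exact hve hvq
  by_cases hwp : G.Adj w p <;> by_cases hwq : G.Adj w q
  · rcases claw_elim hcf hep' heq' hpq' hwe hwp hwq with h | h | h
    · exact hep h
    · exact heq h
    · exact hpq h
  · exact star hcf hcr hk hω v e w q p hve hve' hwv hwe hvq hvp hpq'.symm
      (fun h => hpq h.symm) heq hep hwq hwp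
  · exact star hcf hcr hk hω v e w p q hve hve' hwv hwe hvp hvq hpq' hpq hep heq hwp hwq
  · have hwp' : w ≠ p := by rintro rfl; exact hep hwe.symm
    have hwq' : w ≠ q := by rintro rfl; exact heq hwe.symm
    rcases claw_elim hcf hwp' hwq' hpq' hwv.symm hvp hvq with h | h | h
    · exact hwp h
    · exact hwq h
    · exact hpq h

/-- Main theorem: every claw-free graph `G` with `χ(G) > ω(G)` has a clique `K` with
`|K| ≤ 5` such that `χ(G \ K) > χ(G) - |K|`. -/
theorem stmt14 {V : Type*} [Fintype V] (G : SimpleGraph V) (hcf : ClawFree G)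
    (hχω : (G.cliqueNum : ℕ∞) < G.chromaticNumber) :
    ∃ K : Finset V, G.IsClique (↑K : Set V) ∧ K.card ≤ 5 ∧
      G.chromaticNumber - (K.card : ℕ∞) <
        (G.induce ((↑K : Set V)ᶜ)).chromaticNumber := by
  classical
  by_contra hcon
  push Not at hcon
  have hfin : G.chromaticNumber ≠ ⊤ :=
    chromaticNumber_ne_top_iff_exists.2 ⟨_, G.colorable_of_fintype⟩
  obtain ⟨k, hkχ⟩ := ENat.ne_top_iff_exists.1 hfin
  rw [← hkχ] at hχω hcon
  have hω : G.cliqueNum < k := by exact_mod_cast hχω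
  have hk : ¬ G.Colorable (k - 1) := by
    intro h
    have := h.chromaticNumber_le
    rw [← hkχ] at this
    have : k ≤ k - 1 := by exact_mod_cast this
    omega
  refine core hcf (k := k) ?_ hk hω
  intro K hK hcard
  have hKω := hK.card_le_cliqueNum
  refine ⟨by omega, ?_⟩
  have h := hcon K hK hcard
  rw [← ENat.natCast_sub, chromaticNumber_le_iff_colorable] at h
  obtain ⟨C⟩ := h
  refine ⟨fun x => if hx : x ∈ K then 0 else (C ⟨x, by simpa using hx⟩ : ℕ), ?_, ?_⟩
  · intro x hx
    simp only [hx, dite_false]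
    exact (C _).2
  · intro x y hx hy hxy
    simp only [hx, hy, dite_false]
    intro he
    exact C.valid (v := ⟨x, by simpa using hx⟩) (w := ⟨y, by simpa using hy⟩) (by simpa using hxy)
      (Fin.ext he)
end

section
/- A prismatic graph is orientable if and only if no induced subgraph of it is a twister or a rotator. -/
open SimpleGraph

/-- A graph is prismatic if for every triangle and every vertex outside it, the vertex has
exactly one neighbor in the triangle. -/
def Prismatic {V : Type*} (G : SimpleGraph V) : Prop :=
  ∀ a b c v : V, G.Adj a b → G.Adj b c → G.Adj a c → v ≠ a → v ≠ b → v ≠ c →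
    ((G.Adj v a ∧ ¬ G.Adj v b ∧ ¬ G.Adj v c) ∨
     (¬ G.Adj v a ∧ G.Adj v b ∧ ¬ G.Adj v c) ∨
     (¬ G.Adj v a ∧ ¬ G.Adj v b ∧ G.Adj v c))

/-- `a`, `b`, `c` form a triangle of `G`. -/
def IsTriangle {V : Type*} (G : SimpleGraph V) (a b c : V) : Prop :=
  G.Adj a b ∧ G.Adj b c ∧ G.Adj a c

/-- A prismatic graph is orientable if each of its triangles can be given a cyclic
orientation so that for every two (vertex-)disjoint triangles, the perfect matching of edges
between them carries the orientation of one to the orientation of the other. -/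
def Orientable {V : Type*} (G : SimpleGraph V) : Prop :=
  ∃ D : V → V → Prop,
    (∀ x y, ¬ (D x y ∧ D y x)) ∧
    (∀ a b c, IsTriangle G a b c →
      ((D a b ∧ D b c ∧ D c a) ∨ (D b a ∧ D c b ∧ D a c))) ∧
    (∀ a b c a' b' c', IsTriangle G a b c → IsTriangle G a' b' c' →
      ({a, b, c} : Set V) ∩ {a', b', c'} = ∅ →
      G.Adj a a' → G.Adj b b' → G.Adj c c' → (D a b ↔ D a' b'))

/-- The edges of the rotator. -/
def rotEdges : List (Fin 9 × Fin 9) :=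
  [(0,1),(0,2),(1,2),
   (3,6),(3,7),(3,8),(4,6),(4,7),(4,8),(5,6),(5,7),(5,8),
   (0,3),(0,6),(1,4),(1,7),(2,5),(2,8)]

/-- The edges of the twister: vertices `0,…,7` are `v_1,…,v_8` and `8, 9` are `u_1, u_2`. -/
def twistEdges : List (Fin 10 × Fin 10) :=
  [(0,1),(1,2),(2,3),(3,4),(4,5),(5,6),(6,7),(7,0),
   (0,4),(1,5),(2,6),(3,7),
   (8,0),(8,2),(8,4),(8,6),
   (9,1),(9,3),(9,5),(9,7),
   (8,9)]

/-- `G` contains an induced rotator. -/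
def HasInducedRotator {V : Type*} (G : SimpleGraph V) : Prop :=
  ∃ v : Fin 9 → V, Function.Injective v ∧
    ∀ i j, G.Adj (v i) (v j) ↔ ((i, j) ∈ rotEdges ∨ (j, i) ∈ rotEdges)

/-- `G` contains an induced twister. -/
def HasInducedTwister {V : Type*} (G : SimpleGraph V) : Prop :=
  ∃ v : Fin 10 → V, Function.Injective v ∧
    ∀ i j, G.Adj (v i) (v j) ↔ ((i, j) ∈ twistEdges ∨ (j, i) ∈ twistEdges)

namespace PrismProof

open Equiv

/-- Ordered triangles. -/
def Tri {V : Type*} (G : SimpleGraph V) (t : Fin 3 → V) : Prop :=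
  ∀ i j, i ≠ j → G.Adj (t i) (t j)

/-- Two disjoint ordered triangles, matched index by index. -/
structure R {V : Type*} (G : SimpleGraph V) (a b : Fin 3 → V) : Prop where
  ta : Tri G a
  tb : Tri G b
  dis : ∀ i j, a i ≠ b j
  mat : ∀ i, G.Adj (a i) (b i)

variable {V : Type*} {G : SimpleGraph V}

lemma Tri.comp {t : Fin 3 → V} (h : Tri G t) (σ : Perm (Fin 3)) : Tri G (t ∘ σ) :=
  fun i j hij => h _ _ (fun e => hij (σ.injective e))

lemma Tri.inj {t : Fin 3 → V} (h : Tri G t) : Function.Injective t := by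
  intro i j hij
  by_contra hne
  exact (h i j hne).ne hij

lemma R.comp {a b : Fin 3 → V} (h : R G a b) (σ : Perm (Fin 3)) : R G (a ∘ σ) (b ∘ σ) :=
  ⟨h.ta.comp σ, h.tb.comp σ, fun _ _ => h.dis _ _, fun _ => h.mat _⟩

lemma R.symm {a b : Fin 3 → V} (h : R G a b) : R G b a :=
  ⟨h.tb, h.ta, fun i j e => h.dis j i e.symm, fun i => (h.mat i).symm⟩

lemma pr_uniq (hpr : Prismatic G) {t : Fin 3 → V} (h : Tri G t) {v : V} (hv : ∀ i, v ≠ t i)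
    {i j : Fin 3} (hi : G.Adj v (t i)) (hj : G.Adj v (t j)) : i = j := by
  have := hpr (t 0) (t 1) (t 2) v (h _ _ (by decide)) (h _ _ (by decide)) (h _ _ (by decide))
    (hv 0) (hv 1) (hv 2)
  fin_cases i <;> fin_cases j <;> simp_all

lemma pr_ex (hpr : Prismatic G) {t : Fin 3 → V} (h : Tri G t) {v : V} (hv : ∀ i, v ≠ t i) :
    ∃ i, G.Adj v (t i) := by
  have := hpr (t 0) (t 1) (t 2) v (h _ _ (by decide)) (h _ _ (by decide)) (h _ _ (by decide))
    (hv 0) (hv 1) (hv 2)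
  rcases this with h | h | h
  exacts [⟨0, h.1⟩, ⟨1, h.2.1⟩, ⟨2, h.2.2⟩]

lemma R.idx (hpr : Prismatic G) {a b : Fin 3 → V} (h : R G a b) {i j : Fin 3}
    (hij : G.Adj (a i) (b j)) : i = j :=
  pr_uniq hpr h.tb (h.dis i) (h.mat i) hij

lemma R.iff (hpr : Prismatic G) {a b : Fin 3 → V} (h : R G a b) (i j : Fin 3) :
    G.Adj (a i) (b j) ↔ i = j :=
  ⟨h.idx hpr, fun e => e ▸ h.mat i⟩

lemma Tri.iff {a : Fin 3 → V} (h : Tri G a) (i j : Fin 3) : G.Adj (a i) (a j) ↔ i ≠ j :=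
  ⟨fun e he => e.ne (he ▸ rfl), h i j⟩

lemma match_ex (hpr : Prismatic G) {a b : Fin 3 → V} (ha : Tri G a) (hb : Tri G b)
    (hd : ∀ i j, a i ≠ b j) : ∃ σ : Perm (Fin 3), R G a (b ∘ σ) := by
  choose f hf using fun i => pr_ex hpr hb (hd i)
  have inj : Function.Injective f := by
    intro i j hij
    refine pr_uniq hpr ha (v := b (f i)) (fun k e => hd k _ e.symm) (hf i).symm ?_
    rw [hij]; exact (hf j).symm
  refine ⟨Equiv.ofBijective f (Finite.injective_iff_bijective.mp inj), ha, hb.comp _, ?_, ?_⟩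
  · intro i j; exact hd _ _
  · intro i; exact hf i

lemma label (hpr : Prismatic G) {a b c : Fin 3 → V} (h1 : R G a b) (h2 : R G b c) {i j : Fin 3}
    (e : a i = c j) : i = j := by
  apply h2.idx hpr
  rw [← e]; exact (h1.mat i).symm

lemma two_share (hpr : Prismatic G) {a b c : Fin 3 → V} (h1 : R G a b) (h2 : R G b c)
    {i j : Fin 3} (hij : i ≠ j) (ei : a i = c i) (ej : a j = c j) : a = c := by
  have key : ∀ k, a k = c k := by
    intro k
    by_contra hk
    have hki : k ≠ i := by rintro rfl; exact hk ei
    have hkj : k ≠ j := by rintro rfl; exact hk ej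
    refine hij (pr_uniq hpr h2.tb (v := a k) ?_ (ei ▸ h1.ta k i hki) (ej ▸ h1.ta k j hkj))
    intro m em
    have := label hpr h1 h2 em
    subst this
    exact hk em
  exact funext key

lemma odd_conj : ∀ σ : Perm (Fin 3), Perm.sign σ ≠ 1 → ∃ τ : Perm (Fin 3), σ * τ = τ * swap 1 2 := by
  decide

/-- A bad cycle of three triangles gives a rotator. -/
lemma tri_even (hpr : Prismatic G) (hrot : ¬ HasInducedRotator G) {a b c : Fin 3 → V}
    (h1 : R G a b) (h2 : R G b c) {σ : Perm (Fin 3)} (h3 : R G a (c ∘ σ)) :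
    Perm.sign σ = 1 := by
  by_contra hs
  obtain ⟨τ, hτ⟩ := odd_conj σ hs
  have h1' := h1.comp τ
  have h2' := h2.comp τ
  have h3' := h3.comp τ
  have e : (c ∘ σ) ∘ τ = (c ∘ τ) ∘ (swap 1 2 : Perm (Fin 3)) := by
    have : (⇑σ ∘ ⇑τ) = ⇑τ ∘ ⇑(swap 1 2 : Perm (Fin 3)) := by
      rw [← Perm.coe_mul, hτ, Perm.coe_mul]
    rw [Function.comp_assoc, this, Function.comp_assoc]
  rw [e] at h3'
  clear h1 h2 h3 e
  generalize a ∘ τ = a at *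
  generalize b ∘ τ = b at *
  generalize c ∘ τ = c at *
  have hac : ∀ i j, G.Adj (a i) (c j) ↔ swap 1 2 i = j := by
    intro i j
    have := h3'.iff hpr i (swap 1 2 j)
    simp only [Function.comp, swap_apply_self] at this
    rw [this]
    clear this
    revert i j; decide
  have hA := h1'.ta.iff
  have hB := h1'.tb.iff
  have hC := h2'.tb.iff
  have hab := h1'.iff hpr
  have hbc := h2'.iff hpr
  have hba := h1'.symm.iff hpr
  have hcb := h2'.symm.iff hpr
  have hca : ∀ i j, G.Adj (c i) (a j) ↔ swap 1 2 j = i := fun i j => by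
    rw [G.adj_comm]; exact hac j i
  have nab := h1'.dis
  have nbc := h2'.dis
  have nac : ∀ i j, a i ≠ c j := by
    intro i j e
    exact h3'.dis i (swap 1 2 j) (by simpa using e)
  have na : ∀ i j, a i = a j ↔ i = j := fun _ _ => h1'.ta.inj.eq_iff
  have nb : ∀ i j, b i = b j ↔ i = j := fun _ _ => h1'.tb.inj.eq_iff
  have nc : ∀ i j, c i = c j ↔ i = j := fun _ _ => h2'.tb.inj.eq_iff
  refine hrot ⟨![a 0, b 0, c 0, a 1, b 2, c 1, a 2, b 1, c 2], ?_, ?_⟩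
  · intro i j
    fin_cases i <;> fin_cases j <;>
      simp [na, nb, nc, nab, nbc, nac, fun i j => (nab i j).symm, fun i j => (nbc i j).symm,
        fun i j => (nac i j).symm]
  · intro i j
    fin_cases i <;> fin_cases j <;>
      simp [rotEdges, hA, hB, hC, hab, hbc, hac, hba, hcb, hca] <;> decide

/-- `a` and `c` share exactly the vertex with index `i`. -/
def Meet (a c : Fin 3 → V) (i : Fin 3) : Prop :=
  a i = c i ∧ ∀ j k, a j = c k → j = i ∧ k = i

lemma trich (hpr : Prismatic G) (hrot : ¬ HasInducedRotator G) {a b c : Fin 3 → V}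
    (h1 : R G a b) (h2 : R G b c) :
    a = c ∨ (∃ σ : Perm (Fin 3), Perm.sign σ = 1 ∧ R G a (c ∘ σ)) ∨ ∃ i, Meet a c i := by
  by_cases hd : ∀ i j, a i ≠ c j
  · obtain ⟨σ, hσ⟩ := match_ex hpr h1.ta h2.tb hd
    exact Or.inr (Or.inl ⟨σ, tri_even hpr hrot h1 h2 hσ, hσ⟩)
  · push Not at hd
    obtain ⟨i, j, e⟩ := hd
    have := label hpr h1 h2 e
    subst this
    by_cases hac : a = c
    · exact Or.inl hac
    · refine Or.inr (Or.inr ⟨i, e, ?_⟩)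
      intro j k ejk
      have := label hpr h1 h2 ejk
      subst this
      by_contra hne
      exact hac (two_share hpr h1 h2 (i := i) (j := j) (by tauto) e ejk)

/-- A bad cycle of four triangles gives a twister. -/
lemma quad_even (hpr : Prismatic G) (htw : ¬ HasInducedTwister G) {a b c d : Fin 3 → V}
    (h1 : R G a b) (h2 : R G b c) (h3 : R G c d) {i j : Fin 3} (hi : Meet a c i)
    (hj : Meet b d j) {σ : Perm (Fin 3)} (h4 : R G a (d ∘ σ)) :
    Perm.sign σ = 1 := by
  by_contra hs
  obtain ⟨τ, hτ⟩ := odd_conj σ hs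
  have h1' := h1.comp τ
  have h2' := h2.comp τ
  have h3' := h3.comp τ
  have h4' := h4.comp τ
  have e : (d ∘ σ) ∘ τ = (d ∘ τ) ∘ (swap 1 2 : Perm (Fin 3)) := by
    have : (⇑σ ∘ ⇑τ) = ⇑τ ∘ ⇑(swap 1 2 : Perm (Fin 3)) := by
      rw [← Perm.coe_mul, hτ, Perm.coe_mul]
    rw [Function.comp_assoc, this, Function.comp_assoc]
  rw [e] at h4'
  have mc : ∀ {a c : Fin 3 → V} {i}, Meet a c i → Meet (a ∘ τ) (c ∘ τ) (τ⁻¹ i) := by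
    intro a c i h
    refine ⟨by simpa using h.1, fun j k e => ?_⟩
    have := h.2 _ _ e
    simp [← this.1]
    exact τ.injective (this.2.trans this.1.symm)
  have hi' := mc hi
  have hj' := mc hj
  clear h1 h2 h3 h4 e hi hj mc
  generalize a ∘ τ = a at *
  generalize b ∘ τ = b at *
  generalize c ∘ τ = c at *
  generalize d ∘ τ = d at *
  generalize τ⁻¹ i = i at *
  generalize τ⁻¹ j = j at *
  have had : ∀ i j, G.Adj (a i) (d j) ↔ swap 1 2 i = j := by
    intro i j
    have := h4'.iff hpr i (swap 1 2 j)
    simp only [Function.comp, swap_apply_self] at this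
    rw [this]
    clear this
    revert i j; decide
  have i0 : i = 0 := by
    have := (had i i).1 (hi'.1 ▸ h3'.mat i)
    clear hi'; revert this; revert i; decide
  have j0 : j = 0 := by
    have := (had j j).1 (hj'.1 ▸ h1'.mat j)
    clear hj'; revert this; revert j; decide
  subst i0 j0
  have hca : c 0 = a 0 := hi'.1.symm
  have hdb : d 0 = b 0 := hj'.1.symm
  have hA := h1'.ta.iff
  have hB := h1'.tb.iff
  have hC := h2'.tb.iff
  have hD := h3'.tb.iff
  have hab := h1'.iff hpr
  have hbc := h2'.iff hpr
  have hcd := h3'.iff hpr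
  have hba := h1'.symm.iff hpr
  have hcb := h2'.symm.iff hpr
  have hdc := h3'.symm.iff hpr
  have hda : ∀ i j, G.Adj (d i) (a j) ↔ swap 1 2 j = i := fun i j => by
    rw [G.adj_comm]; exact had j i
  have nab := h1'.dis
  have nbc := h2'.dis
  have ncd := h3'.dis
  have nad : ∀ i j, a i ≠ d j := by
    intro i j e
    exact h4'.dis i (swap 1 2 j) (by simpa using e)
  have nac : ∀ i j, j ≠ 0 → a i ≠ c j := fun i j hj e => hj (hi'.2 i j e).2
  have nbd : ∀ i j, j ≠ 0 → b i ≠ d j := fun i j hj e => hj (hj'.2 i j e).2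
  have hac : ∀ i j, j ≠ 0 → (G.Adj (a i) (c j) ↔ i = 0) := by
    intro i j hj
    constructor
    · intro h
      refine pr_uniq hpr h1'.ta (v := c j) (fun k e => nac k j hj e.symm) h.symm ?_
      rw [← hca]; exact h2'.tb _ _ hj
    · rintro rfl
      rw [← hca]; exact h2'.tb _ _ hj.symm
  have hbd : ∀ i j, j ≠ 0 → (G.Adj (b i) (d j) ↔ i = 0) := by
    intro i j hj
    constructor
    · intro h
      refine pr_uniq hpr h1'.tb (v := d j) (fun k e => nbd k j hj e.symm) h.symm ?_
      rw [← hdb]; exact h3'.tb _ _ hj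
    · rintro rfl
      rw [← hdb]; exact h3'.tb _ _ hj.symm
  have hca' : ∀ i j, j ≠ 0 → (G.Adj (c j) (a i) ↔ i = 0) := fun i j hj => by
    rw [G.adj_comm]; exact hac i j hj
  have hdb' : ∀ i j, j ≠ 0 → (G.Adj (d j) (b i) ↔ i = 0) := fun i j hj => by
    rw [G.adj_comm]; exact hbd i j hj
  have na : ∀ i j, a i = a j ↔ i = j := fun _ _ => h1'.ta.inj.eq_iff
  have nb : ∀ i j, b i = b j ↔ i = j := fun _ _ => h1'.tb.inj.eq_iff
  have nc : ∀ i j, c i = c j ↔ i = j := fun _ _ => h2'.tb.inj.eq_iff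
  have nd : ∀ i j, d i = d j ↔ i = j := fun _ _ => h3'.tb.inj.eq_iff
  refine htw ⟨![a 1, b 1, c 1, d 1, a 2, b 2, c 2, d 2, a 0, b 0], ?_, ?_⟩
  · intro i j
    fin_cases i <;> fin_cases j <;>
      simp [na, nb, nc, nd, nab, nbc, ncd, nad, nac, nbd, fun i j => (nab i j).symm,
        fun i j => (nbc i j).symm, fun i j => (ncd i j).symm, fun i j => (nad i j).symm,
        fun i j h => (nac i j h).symm, fun i j h => (nbd i j h).symm]
  · intro i j
    fin_cases i <;> fin_cases j <;>
      simp [twistEdges, hA, hB, hC, hD, hab, hbc, hcd, had, hba, hcb, hdc, hda, hac, hbd,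
        hca', hdb'] <;> decide

/-- `C n t u`: there is a chain of `n` matched steps from `t` to an even rearrangement of `u`. -/
def C (G : SimpleGraph V) : ℕ → (Fin 3 → V) → (Fin 3 → V) → Prop
  | 0, t, u => ∃ σ : Perm (Fin 3), Perm.sign σ = 1 ∧ t = u ∘ σ
  | n + 1, t, u => ∃ x, R G t x ∧ C G n x u

lemma C.compl {n : ℕ} {t u : Fin 3 → V} (h : C G n t u) {σ : Perm (Fin 3)}
    (hσ : Perm.sign σ = 1) : C G n (t ∘ σ) u := by
  induction n generalizing t with
  | zero =>
    obtain ⟨τ, h1, h2⟩ := h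
    refine ⟨τ * σ, by simp [h1, hσ], ?_⟩
    rw [h2, Perm.coe_mul]; rfl
  | succ n ih =>
    obtain ⟨x, hx, h⟩ := h
    exact ⟨x ∘ σ, hx.comp σ, ih h⟩

/-- step through an evenly rearranged intermediate triangle -/
lemma C.step {n : ℕ} {t x u : Fin 3 → V}
    (hx : ∃ σ : Perm (Fin 3), Perm.sign σ = 1 ∧ R G t (x ∘ σ)) (h : C G n x u) :
    C G (n + 1) t u := by
  obtain ⟨σ, hs, hx⟩ := hx
  exact ⟨_, hx, h.compl hs⟩

lemma C.trans {m n : ℕ} {t u w : Fin 3 → V} (h : C G m t u) (h' : C G n u w) :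
    C G (m + n) t w := by
  induction m generalizing t with
  | zero =>
    obtain ⟨σ, hs, rfl⟩ := h
    rw [Nat.zero_add]; exact h'.compl hs
  | succ m ih =>
    obtain ⟨x, hx, h⟩ := h
    rw [Nat.succ_add]
    exact ⟨x, hx, ih h⟩

lemma C.refl (t : Fin 3 → V) : C G 0 t t := ⟨1, by simp, rfl⟩

lemma C.one {t u : Fin 3 → V} (h : R G t u) : C G 1 t u := ⟨u, h, C.refl u⟩

lemma C.symm {n : ℕ} {t u : Fin 3 → V} (h : C G n t u) : C G n u t := by
  induction n generalizing t with
  | zero =>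
    obtain ⟨σ, hs, rfl⟩ := h
    refine ⟨σ⁻¹, by simp [hs], ?_⟩
    funext i; simp
  | succ n ih =>
    obtain ⟨x, hx, h⟩ := h
    exact (ih h).trans (C.one hx.symm)

lemma C.rev {n : ℕ} {t u : Fin 3 → V} (h : C G n t u) (τ : Perm (Fin 3)) :
    C G n (t ∘ τ) (u ∘ τ) := by
  induction n generalizing t with
  | zero =>
    obtain ⟨σ, hs, rfl⟩ := h
    refine ⟨τ⁻¹ * σ * τ, by simp [hs], ?_⟩
    funext i; simp
  | succ n ih =>
    obtain ⟨x, hx, h⟩ := h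
    exact ⟨x ∘ τ, hx.comp τ, ih h⟩

/-- even matching -/
def Ev (G : SimpleGraph V) (a b : Fin 3 → V) : Prop :=
  ∃ σ : Perm (Fin 3), Perm.sign σ = 1 ∧ R G a (b ∘ σ)

/-- Chain of three steps: shortcut or structure. -/
lemma three (hpr : Prismatic G) (hrot : ¬ HasInducedRotator G) (htw : ¬ HasInducedTwister G)
    {a b c d : Fin 3 → V} (h1 : R G a b) (h2 : R G b c) (h3 : R G c d) :
    a = c ∨ b = d ∨ Ev G a c ∨ Ev G b d ∨ Ev G a d ∨
      ∃ i j, i ≠ j ∧ Meet a c i ∧ Meet b d j ∧ a j = d i := by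
  rcases trich hpr hrot h1 h2 with h | h | ⟨i, hi⟩
  · exact Or.inl h
  · exact Or.inr (Or.inr (Or.inl h))
  rcases trich hpr hrot h2 h3 with h | h | ⟨j, hj⟩
  · exact Or.inr (Or.inl h)
  · exact Or.inr (Or.inr (Or.inr (Or.inl h)))
  by_cases hd : ∀ i j, a i ≠ d j
  · obtain ⟨σ, hσ⟩ := match_ex hpr h1.ta h3.tb hd
    exact Or.inr (Or.inr (Or.inr (Or.inr (Or.inl ⟨σ, quad_even hpr htw h1 h2 h3 hi hj hσ, hσ⟩))))
  push Not at hd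
  obtain ⟨p, q, e⟩ := hd
  refine Or.inr (Or.inr (Or.inr (Or.inr (Or.inr ⟨i, j, ?_, hi, hj, ?_⟩))))
  all_goals
    have pi : p ≠ i := by
      rintro rfl
      exact h3.dis p q (hi.1.symm.trans e)
    have qi : i = q := by
      apply h3.idx hpr
      rw [← hi.1, ← e]; exact h1.ta _ _ pi.symm
    subst qi
    have ji : j ≠ i := by
      rintro rfl
      exact h1.dis p j (e.trans hj.1.symm)
    have jp : j = p := by
      apply h1.symm.idx hpr
      rw [hj.1, e]; exact h3.tb _ _ ji
    subst jp
  · exact ji.symm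
  · exact e

lemma even_fin3 : ∀ (σ : Perm (Fin 3)) (i j k : Fin 3), i ≠ j → j ≠ k → i ≠ k →
    σ j = i → σ k = j → Perm.sign σ = 1 := by decide

lemma even_fin3' : ∀ (σ : Perm (Fin 3)) (i j : Fin 3), i ≠ j →
    σ i = i → σ j = j → Perm.sign σ = 1 := by decide

lemma R.perm (hpr : Prismatic G) {a b : Fin 3 → V} {σ : Perm (Fin 3)} (h : R G a (b ∘ σ))
    {i j : Fin 3} (hij : G.Adj (a i) (b j)) : σ i = j := by
  have : i = σ⁻¹ j := h.idx hpr (by simpa using hij)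
  rw [this]; simp

/-- Chains of five steps can be shortened. -/
lemma five (hpr : Prismatic G) (hrot : ¬ HasInducedRotator G) (htw : ¬ HasInducedTwister G)
    {a b c d e f : Fin 3 → V} (h1 : R G a b) (h2 : R G b c) (h3 : R G c d) (h4 : R G d e)
    (h5 : R G e f) : ∃ m < 5, C G m a f := by
  have k1 := C.one h1
  have k2 := C.one h2
  have k3 := C.one h3
  have k4 := C.one h4
  have k5 := C.one h5
  have ev : ∀ {x y}, Ev G x y → C G 1 x y := fun h => C.step h (C.refl _)
  rcases three hpr hrot htw h1 h2 h3 with h | h | h | h | h | ⟨i, j, hij, hi, hj, had⟩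
  · subst h; exact ⟨_, by norm_num, k3.trans (k4.trans k5)⟩
  · subst h; exact ⟨_, by norm_num, k1.trans (k4.trans k5)⟩
  · exact ⟨_, by norm_num, (ev h).trans (k3.trans (k4.trans k5))⟩
  · exact ⟨_, by norm_num, k1.trans ((ev h).trans (k4.trans k5))⟩
  · exact ⟨_, by norm_num, (ev h).trans (k4.trans k5)⟩
  rcases three hpr hrot htw h2 h3 h4 with h | h | h | h | h | ⟨j', k, hjk, hj', hk, hbe⟩
  · subst h; exact ⟨_, by norm_num, k1.trans (k4.trans k5)⟩
  · subst h; exact ⟨_, by norm_num, k1.trans (k2.trans k5)⟩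
  · exact ⟨_, by norm_num, k1.trans ((ev h).trans (k4.trans k5))⟩
  · exact ⟨_, by norm_num, k1.trans (k2.trans ((ev h).trans k5))⟩
  · exact ⟨_, by norm_num, k1.trans ((ev h).trans k5)⟩
  obtain rfl : j' = j := (hj.2 _ _ hj'.1).1
  rcases three hpr hrot htw h3 h4 h5 with h | h | h | h | h | ⟨k', l, hkl, hk', hl, hcf⟩
  · subst h; exact ⟨_, by norm_num, k1.trans (k2.trans k5)⟩
  · subst h; exact ⟨_, by norm_num, k1.trans (k2.trans k3)⟩
  · exact ⟨_, by norm_num, k1.trans (k2.trans ((ev h).trans k5))⟩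
  · exact ⟨_, by norm_num, k1.trans (k2.trans (k3.trans (ev h)))⟩
  · exact ⟨_, by norm_num, k1.trans (k2.trans (ev h))⟩
  obtain rfl : k' = k := (hk.2 _ _ hk'.1).1
  have five_cycle : ∀ {a b c d e : Fin 3 → V} {i j k : Fin 3}, R G a b → R G b c → R G c d →
      R G d e → i ≠ j → j ≠ k → Meet a c i → Meet c e k → a j = d i → b k = e j →
      Ev G a e ∨ k = i := by
    intro a b c d e i j k h1 h2 h3 h4 hij hjk hi hk had hbe
    by_cases hki : k = i
    · exact Or.inr hki
    left
    by_cases hd : ∀ i j, a i ≠ e j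
    · obtain ⟨σ, hσ⟩ := match_ex hpr h1.ta h4.tb hd
      refine ⟨σ, even_fin3 σ i j k hij hjk (Ne.symm hki) ?_ ?_, hσ⟩
      · apply hσ.perm hpr; rw [had]; exact h4.mat i
      · apply hσ.perm hpr; rw [← hbe]; exact h1.mat k
    · exfalso
      push Not at hd
      obtain ⟨p, q, epq⟩ := hd
      have hie : ∀ m, a i ≠ e m := by
        intro m em
        rw [hi.1] at em
        exact hki (hk.2 _ _ em).1.symm
      have hpi : i ≠ p := by rintro rfl; exact hie _ epq
      have hqk : q = k := by
        refine pr_uniq hpr h4.tb hie ?_ ?_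
        · rw [← epq]; exact h1.ta _ _ hpi
        · rw [hi.1, ← hk.1]; exact h2.tb _ _ (Ne.symm hki)
      subst hqk
      rw [← hk.1] at epq
      exact hki (hi.2 _ _ epq).2
  rcases five_cycle h1 h2 h3 h4 hij hjk hi hk had hbe with h | hki
  · exact ⟨_, by norm_num, (ev h).trans k5⟩
  rcases five_cycle h2 h3 h4 h5 hjk hkl hj hl hbe hcf with h | hlj
  · exact ⟨_, by norm_num, k1.trans (ev h)⟩
  subst hki hlj
  by_cases hd : ∀ i j, a i ≠ f j
  · obtain ⟨σ, hσ⟩ := match_ex hpr h1.ta h5.tb hd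
    refine ⟨1, by norm_num, ev ⟨σ, even_fin3' σ _ _ hij ?_ ?_, hσ⟩⟩
    · apply hσ.perm hpr; rw [hi.1, hk.1]; exact h5.mat _
    · apply hσ.perm hpr; rw [← hl.1, ← hj.1]; exact h1.mat _
  · exfalso
    push Not at hd
    obtain ⟨p, q, epq⟩ := hd
    have hfb : f l = b l := by rw [← hl.1, ← hj.1]
    have hql : l ≠ q := by
      rintro rfl
      exact h1.dis _ _ (epq.trans hfb)
    have hlp : l = p := by
      apply h1.symm.idx hpr
      rw [← hfb, epq]; exact h5.tb _ _ hql
    subst hlp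
    rw [had] at epq
    exact hij (hl.2 _ _ epq).1

lemma no_bad (hpr : Prismatic G) (hrot : ¬ HasInducedRotator G) (htw : ¬ HasInducedTwister G)
    (n : ℕ) (t : Fin 3 → V) (ht : Tri G t) (σ : Perm (Fin 3)) (hσ : Perm.sign σ ≠ 1) :
    ¬ C G n t (t ∘ σ) := by
  have ev : ∀ {x y}, Ev G x y → C G 1 x y := fun h => C.step h (C.refl _)
  induction n using Nat.strong_induction_on with
  | _ n ih =>
  intro h
  match n, ih, h with
  | 0, _, h =>
    obtain ⟨τ, hτ, e⟩ := h
    have : σ * τ = 1 := by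
      ext i
      have := congrFun e i
      simp only [Function.comp] at this
      rw [Perm.mul_apply, ← ht.inj this]; rfl
    have := congrArg Perm.sign this
    simp [hτ] at this
    exact hσ this
  | 1, _, ⟨x, hx, τ, hτ, e⟩ =>
    subst e
    exact hx.dis (σ (τ 0)) 0 rfl
  | 2, ih, ⟨x, hx, y, hy, τ, hτ, e⟩ =>
    apply ih 0 (by norm_num)
    refine ⟨τ, hτ, ?_⟩
    rw [← e]
    funext i
    have : y i = t (σ (τ i)) := congrFun e i
    have := label hpr hx hy this.symm
    rw [e]; simp only [Function.comp]; rw [← this]; simp [this]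
  | 3, ih, ⟨x, hx, y, hy, z, hz, h⟩ =>
    rcases trich hpr hrot hx hy with h' | h' | ⟨i, hi⟩
    · subst h'
      exact ih 1 (by norm_num) ⟨z, hz, h⟩
    · exact ih 2 (by norm_num) ((ev h').trans (m := 1) (n := 1) ⟨z, hz, h⟩)
    · obtain ⟨τ, hτ, e⟩ := h
      subst e
      apply hz.dis i ((σ * τ)⁻¹ i)
      rw [← hi.1]; simp
  | 4, ih, ⟨x, hx, y, hy, z, hz, w, hw, h⟩ =>
    have hC0 : C G 0 w (t ∘ σ) := h
    rcases three hpr hrot htw hx hy hz with h' | h' | h' | h' | h' | ⟨i, j, _, _, _, e'⟩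
    · subst h'
      exact ih 2 (by norm_num) ⟨z, hz, w, hw, h⟩
    · subst h'
      exact ih 2 (by norm_num) ⟨x, hx, w, hw, h⟩
    · exact ih 3 (by norm_num) ((ev h').trans (m := 1) (n := 2) ⟨z, hz, w, hw, h⟩)
    · exact ih 3 (by norm_num) ((C.one hx).trans ((ev h').trans (m := 1) (n := 1) ⟨w, hw, h⟩))
    · exact ih 2 (by norm_num) ((ev h').trans (m := 1) (n := 1) ⟨w, hw, h⟩)
    · obtain ⟨τ, hτ, e⟩ := h
      subst e
      apply hw.dis i ((σ * τ)⁻¹ j)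
      rw [← e']; simp
  | n + 5, ih, ⟨b, h1, c, h2, d, h3, e, h4, f, h5, h⟩ =>
    obtain ⟨m, hm, hc⟩ := five hpr hrot htw h1 h2 h3 h4 h5
    exact ih (m + n) (by omega) (hc.trans h)

/-- Equivalence of ordered triples. -/
def S (G : SimpleGraph V) : Setoid (Fin 3 → V) where
  r t u := ∃ n, C G n t u
  iseqv := ⟨fun t => ⟨0, C.refl t⟩, fun ⟨n, h⟩ => ⟨n, h.symm⟩,
    fun ⟨_, h⟩ ⟨_, h'⟩ => ⟨_, h.trans h'⟩⟩

lemma tri_of {a b c : V} (h : IsTriangle G a b c) : Tri G ![a, b, c] := by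
  obtain ⟨h1, h2, h3⟩ := h
  intro i j hij
  fin_cases i <;> fin_cases j <;> simp_all [G.adj_comm]

lemma of_tri {a b c : V} (h : Tri G ![a, b, c]) : IsTriangle G a b c :=
  ⟨h 0 1 (by decide), h 1 2 (by decide), h 0 2 (by decide)⟩

lemma third_unique (hpr : Prismatic G) {a b c d : V} (h : IsTriangle G a b c)
    (h' : IsTriangle G a b d) : c = d := by
  by_contra hne
  have := hpr a b c d h.1 h.2.1 h.2.2 h'.2.2.ne.symm h'.2.1.ne.symm (Ne.symm hne)
  have e1 := h'.2.2.symm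
  have e2 := h'.2.1.symm
  tauto

lemma backward (hpr : Prismatic G) (htw : ¬ HasInducedTwister G) (hrot : ¬ HasInducedRotator G) :
    Orientable G := by
  classical
  let Q := Quotient (S G)
  let _ : LinearOrder Q := linearOrderOfSTO (WellOrderingRel (α := Q))
  let q : (Fin 3 → V) → Q := fun t => Quotient.mk (S G) t
  let r : (Fin 3 → V) → (Fin 3 → V) := fun t => t ∘ (swap 0 1 : Perm (Fin 3))
  have rr : ∀ t, r (r t) = t := by intro t; funext i; simp [r]
  have hq : ∀ {t u n}, C G n t u → q t = q u := fun {t u n} h => Quotient.sound ⟨n, h⟩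
  have hqr : ∀ {t u n}, C G n t u → q (r t) = q (r u) := fun {t u n} h => hq (h.rev _)
  have hne : ∀ t, Tri G t → q t ≠ q (r t) := by
    intro t ht e
    obtain ⟨n, hn⟩ := Quotient.exact e
    exact no_bad hpr hrot htw n t ht _ (by decide) hn
  let ch : (Fin 3 → V) → Prop := fun t => q t < q (r t)
  have chC : ∀ {t u n}, C G n t u → (ch t ↔ ch u) := by
    intro t u n h
    simp only [ch, hq h, hqr h]
  have rv : ∀ x y z : V, r ![x, y, z] = ![y, x, z] := by
    intro x y z; funext i; fin_cases i <;> simp [r] <;> rfl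
  have rot : ∀ x y z : V, C G 0 ![x, y, z] ![y, z, x] := by
    intro x y z
    refine ⟨swap 0 1 * swap 0 2, by decide, ?_⟩
    funext i; fin_cases i <;> rfl
  have chrot : ∀ x y z : V, ch ![x, y, z] ↔ ch ![y, z, x] := fun x y z => chC (rot x y z)
  have dich : ∀ x y z : V, IsTriangle G x y z → ch ![x, y, z] ∨ ch ![y, x, z] := by
    intro x y z h
    rcases lt_or_gt_of_ne (hne _ (tri_of h)) with h | h
    · exact Or.inl h
    · right
      have : ch (r ![x, y, z]) := by simp only [ch, rr]; exact h
      rwa [rv] at this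
  have anti : ∀ x y z : V, ch ![x, y, z] → ¬ ch ![y, x, z] := by
    intro x y z h h'
    rw [← rv] at h'
    simp only [ch, rr] at h h'
    exact lt_asymm h h'
  have t1 : ∀ {x y z : V}, IsTriangle G x y z → IsTriangle G y z x :=
    fun h => ⟨h.2.1, h.2.2.symm, h.1.symm⟩
  have t2 : ∀ {x y z : V}, IsTriangle G x y z → IsTriangle G y x z :=
    fun h => ⟨h.1.symm, h.2.2, h.2.1⟩
  have Dch : ∀ {x y z : V}, IsTriangle G x y z →
      ((∃ w, IsTriangle G x y w ∧ ch ![x, y, w]) ↔ ch ![x, y, z]) := by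
    intro x y z h
    constructor
    · rintro ⟨w, hw, hc⟩
      rwa [third_unique hpr h hw]
    · exact fun hc => ⟨z, h, hc⟩
  refine ⟨fun x y => ∃ z, IsTriangle G x y z ∧ ch ![x, y, z], ?_, ?_, ?_⟩
  · rintro x y ⟨⟨z, hz, hc⟩, h⟩
    exact anti _ _ _ hc ((Dch (t2 hz)).1 h)
  · intro a b c h
    have d1 := Dch h
    have d2 := Dch (t1 h)
    have d3 := Dch (t1 (t1 h))
    have d4 := Dch (t2 h)
    have d5 := Dch (t2 (t1 h))
    have d6 := Dch (t2 (t1 (t1 h)))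
    have c1 := chrot a b c
    have c2 := chrot b c a
    have c3 := chrot b a c
    have c4 := chrot c b a
    rcases dich _ _ _ h with h | h
    · left; exact ⟨d1.2 h, d2.2 (c1.1 h), d3.2 (c2.1 (c1.1 h))⟩
    · right; exact ⟨d4.2 h, d5.2 (c4.2 h), d6.2 (c3.1 h)⟩
  · intro a b c a' b' c' h h' hd ha hb hc
    show (∃ z, IsTriangle G a b z ∧ ch ![a, b, z]) ↔ (∃ z, IsTriangle G a' b' z ∧ ch ![a', b', z])
    rw [Dch h, Dch h']
    refine chC (C.one ⟨tri_of h, tri_of h', ?_, ?_⟩)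
    · intro i j e
      have m1 : ![a, b, c] i ∈ ({a, b, c} : Set V) := by fin_cases i <;> simp
      have m2 : ![a, b, c] i ∈ ({a', b', c'} : Set V) := by rw [e]; fin_cases j <;> simp
      have : ![a, b, c] i ∈ (∅ : Set V) := hd ▸ ⟨m1, m2⟩
      exact this
    · intro i
      fin_cases i
      exacts [ha, hb, hc]

lemma no_rot (h : Orientable G) : ¬ HasInducedRotator G := by
  rintro ⟨v, inj, hv⟩
  obtain ⟨D, anti, htri, hm⟩ := h
  have adj : ∀ i j, ((i, j) ∈ rotEdges ∨ (j, i) ∈ rotEdges) → G.Adj (v i) (v j) :=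
    fun i j => (hv i j).2
  have tr : ∀ i j k, ((i, j) ∈ rotEdges ∨ (j, i) ∈ rotEdges) →
      ((j, k) ∈ rotEdges ∨ (k, j) ∈ rotEdges) → ((i, k) ∈ rotEdges ∨ (k, i) ∈ rotEdges) →
      IsTriangle G (v i) (v j) (v k) :=
    fun i j k h1 h2 h3 => ⟨adj _ _ h1, adj _ _ h2, adj _ _ h3⟩
  have dis : ∀ i j k i' j' k' : Fin 9, (∀ x ∈ [i, j, k], ∀ y ∈ [i', j', k'], x ≠ y) →
      ({v i, v j, v k} : Set V) ∩ {v i', v j', v k'} = ∅ := by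
    intro i j k i' j' k' h
    ext x
    simp at h
    simp only [Set.mem_inter_iff, Set.mem_insert_iff, Set.mem_singleton_iff,
      Set.mem_empty_iff_false, iff_false]
    rintro ⟨rfl | rfl | rfl, h' | h' | h'⟩ <;> have := inj h' <;> tauto
  have e1 := hm _ _ _ _ _ _ (tr 0 3 6 (by decide) (by decide) (by decide))
    (tr 1 7 4 (by decide) (by decide) (by decide)) (dis _ _ _ _ _ _ (by decide))
    (adj _ _ (by decide)) (adj _ _ (by decide)) (adj _ _ (by decide))
  have e2 := hm _ _ _ _ _ _ (tr 1 7 4 (by decide) (by decide) (by decide))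
    (tr 2 5 8 (by decide) (by decide) (by decide)) (dis _ _ _ _ _ _ (by decide))
    (adj _ _ (by decide)) (adj _ _ (by decide)) (adj _ _ (by decide))
  have e3 := hm _ _ _ _ _ _ (tr 2 5 8 (by decide) (by decide) (by decide))
    (tr 0 6 3 (by decide) (by decide) (by decide)) (dis _ _ _ _ _ _ (by decide))
    (adj _ _ (by decide)) (adj _ _ (by decide)) (adj _ _ (by decide))
  have e4 := htri _ _ _ (tr 0 3 6 (by decide) (by decide) (by decide))
  have a1 := anti (v 0) (v 3)
  have a2 := anti (v 0) (v 6)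
  tauto

lemma no_twist (h : Orientable G) : ¬ HasInducedTwister G := by
  rintro ⟨v, inj, hv⟩
  obtain ⟨D, anti, htri, hm⟩ := h
  have adj : ∀ i j, ((i, j) ∈ twistEdges ∨ (j, i) ∈ twistEdges) → G.Adj (v i) (v j) :=
    fun i j => (hv i j).2
  have tr : ∀ i j k, ((i, j) ∈ twistEdges ∨ (j, i) ∈ twistEdges) →
      ((j, k) ∈ twistEdges ∨ (k, j) ∈ twistEdges) → ((i, k) ∈ twistEdges ∨ (k, i) ∈ twistEdges) →
      IsTriangle G (v i) (v j) (v k) :=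
    fun i j k h1 h2 h3 => ⟨adj _ _ h1, adj _ _ h2, adj _ _ h3⟩
  have dis : ∀ i j k i' j' k' : Fin 10, (∀ x ∈ [i, j, k], ∀ y ∈ [i', j', k'], x ≠ y) →
      ({v i, v j, v k} : Set V) ∩ {v i', v j', v k'} = ∅ := by
    intro i j k i' j' k' h
    ext x
    simp at h
    simp only [Set.mem_inter_iff, Set.mem_insert_iff, Set.mem_singleton_iff,
      Set.mem_empty_iff_false, iff_false]
    rintro ⟨rfl | rfl | rfl, h' | h' | h'⟩ <;> have := inj h' <;> tauto
  have e1 := hm _ _ _ _ _ _ (tr 8 0 4 (by decide) (by decide) (by decide))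
    (tr 9 1 5 (by decide) (by decide) (by decide)) (dis _ _ _ _ _ _ (by decide))
    (adj _ _ (by decide)) (adj _ _ (by decide)) (adj _ _ (by decide))
  have e2 := hm _ _ _ _ _ _ (tr 9 1 5 (by decide) (by decide) (by decide))
    (tr 8 2 6 (by decide) (by decide) (by decide)) (dis _ _ _ _ _ _ (by decide))
    (adj _ _ (by decide)) (adj _ _ (by decide)) (adj _ _ (by decide))
  have e3 := hm _ _ _ _ _ _ (tr 8 2 6 (by decide) (by decide) (by decide))
    (tr 9 3 7 (by decide) (by decide) (by decide)) (dis _ _ _ _ _ _ (by decide))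
    (adj _ _ (by decide)) (adj _ _ (by decide)) (adj _ _ (by decide))
  have e3' := hm _ _ _ _ _ _ (tr 9 3 7 (by decide) (by decide) (by decide))
    (tr 8 4 0 (by decide) (by decide) (by decide)) (dis _ _ _ _ _ _ (by decide))
    (adj _ _ (by decide)) (adj _ _ (by decide)) (adj _ _ (by decide))
  have e4 := htri _ _ _ (tr 8 0 4 (by decide) (by decide) (by decide))
  have a1 := anti (v 8) (v 0)
  have a2 := anti (v 8) (v 4)
  tauto

end PrismProof

/-- A prismatic graph is orientable iff no induced subgraph of it is a twister or a
rotator. -/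
theorem stmt17 {V : Type*} (G : SimpleGraph V) (hpr : Prismatic G) :
    Orientable G ↔ (¬ HasInducedTwister G ∧ ¬ HasInducedRotator G) := by
  exact ⟨fun h => ⟨PrismProof.no_twist h, PrismProof.no_rot h⟩,
    fun h => PrismProof.backward hpr h.1 h.2⟩
end
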